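/- arXiv:1502.00334 — 3 statements merged into one kernel-verified Lean document; each statement's English description precedes it below -/
import Mathlib

section
/- Let m ≥ 1 and a, b_1,…,b_m, c_1,…,c_m ∈ ℂ with β_{0,i} = b_i ≠ 0, β_{1,i} = c_i − 1 − b_i ≠ 0 for all i, and γ_w = a − Σ_i w_i c_i + |w| ≠ 0 for all w ∈ {0,1}^m (note γ_{(0,…,0)} = a). Let C be the 2^m × 2^m matrix indexed by {0,1}^m with entries C_{v,v'} = Σ_{w∈{0,1}^m} A_w · ∏_{i: w_i = 0} δ(v_i, v'_i)/β_{v_i,i}, where δ is the Kronecker delta, the product over the empty set is 1, A_{(0,…,0)} = 1, and for |w| = r ≥ 1, A_w = Σ ∏_{j=1}^r 1/γ_{w^{(j)}}, the sum running over all chains w = w^{(r)} ≻ w^{(r−1)} ≻ ⋯ ≻ w^{(1)} in {0,1}^m with |w^{(j)}| = j, where v ⪰ w means (w_i = 1 ⟹ v_i = 1). Then det(C) = a^{2^m} / ((∏_{w∈{0,1}^m} γ_w)·(∏_{i=1}^m (β_{0,i} β_{1,i})^{2^{m−1}})). In particular C is invertible. -/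
open Finset
open scoped Classical

/-- `v_i ∈ {0,1}` regarded as a complex number. -/
noncomputable def bval (s : Bool) : ℂ := if s then 1 else 0

/-- The parameters `β_{0,i} = b_i`, `β_{1,i} = c_i − 1 − b_i`. -/
noncomputable def betaP {m : ℕ} (b c : Fin m → ℂ) (s : Bool) (i : Fin m) : ℂ :=
  if s then c i - 1 - b i else b i

/-- `σ_k·v` : flip the `k`-th coordinate of `v`. -/
def flipv {m : ℕ} (k : Fin m) (v : Fin m → Bool) : Fin m → Bool :=
  Function.update v k (!(v k))

/-- The weight `|v| = Σ v_i` of `v ∈ {0,1}^m`. -/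
def wt {m : ℕ} (v : Fin m → Bool) : ℕ := ∑ i, if v i then 1 else 0

/-- `γ_w = a − Σ_i w_i c_i + |w|`. -/
noncomputable def gammaP {m : ℕ} (a : ℂ) (c : Fin m → ℂ) (w : Fin m → Bool) : ℂ :=
  a - ∑ i, (if w i then c i else 0) + (wt w : ℂ)

/-- `A_w = Σ ∏_{j=1}^r 1/γ_{w^{(j)}}`, the sum over all chains
`w = w^{(r)} ≻ w^{(r−1)} ≻ ⋯ ≻ w^{(1)}` with `|w^{(j)}| = j` (here `r = |w|`;
a chain is encoded as `ch : Fin r → {0,1}^m` with `ch j = w^{(j+1)}`, the conditions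
on weights making the inclusions automatically strict);
for `w = (0,…,0)` the empty chain gives `A_w = 1`. -/
noncomputable def Aw {m : ℕ} (γ : (Fin m → Bool) → ℂ) (w : Fin m → Bool) : ℂ :=
  ∑ ch ∈ (univ : Finset (Fin (wt w) → Fin m → Bool)).filter
      (fun ch =>
        (∀ j : Fin (wt w), wt (ch j) = j.val + 1) ∧
        (∀ j : Fin (wt w), j.val = wt w - 1 → ch j = w) ∧
        (∀ j j' : Fin (wt w), j'.val = j.val + 1 →
          ∀ i, ch j i = true → ch j' i = true)),
    ∏ j, 1 / γ (ch j)

/-- The intersection matrix `C` with entries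
`C_{v,v'} = Σ_w A_w · ∏_{i : w_i = 0} δ(v_i, v'_i)/β_{v_i,i}`. -/
noncomputable def Cmat {m : ℕ} (a : ℂ) (b c : Fin m → ℂ) :
    Matrix (Fin m → Bool) (Fin m → Bool) ℂ :=
  fun v v' => ∑ w, Aw (gammaP a c) w *
    ∏ i ∈ univ.filter (fun i => w i = false),
      (if v i = v' i then 1 else 0) / betaP b c (v i) i

/-- `w` with its `i`-th coordinate set to `false`. -/
def dropAt {m : ℕ} (w : Fin m → Bool) (i : Fin m) : Fin m → Bool :=
  Function.update w i false

/-- The chains `ch 0 ≺ ch 1 ≺ ⋯` of length `n` ending in `w`, with `ch j` of weight `j + 1`. -/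
def IsWtChain {m : ℕ} (n : ℕ) (w : Fin m → Bool) (ch : Fin n → Fin m → Bool) : Prop :=
  (∀ j : Fin n, wt (ch j) = j.val + 1) ∧
    (∀ j : Fin n, j.val = n - 1 → ch j = w) ∧
    (∀ j j' : Fin n, j'.val = j.val + 1 → ∀ i, ch j i = true → ch j' i = true)

/-- The sum of `∏ 1 / γ` over the chains of length `n` ending in `w`. -/
noncomputable def chainSum {m : ℕ} (γ : (Fin m → Bool) → ℂ) (n : ℕ) (w : Fin m → Bool) : ℂ :=
  ∑ ch : Fin n → Fin m → Bool, if IsWtChain n w ch then ∏ j, 1 / γ (ch j) else 0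

theorem Aw_eq_chainSum {m : ℕ} (γ : (Fin m → Bool) → ℂ) (w : Fin m → Bool) :
    Aw γ w = chainSum γ (wt w) w := by
  rw [Aw, chainSum, Finset.sum_filter]
  refine Finset.sum_congr rfl fun ch _ => ?_
  congr 1

theorem wt_eq_card {m : ℕ} (w : Fin m → Bool) : wt w = #{i | w i = true} := by
  simp [wt]

theorem wt_dropAt {m : ℕ} {w : Fin m → Bool} {i : Fin m} (hi : w i = true) :
    wt (dropAt w i) + 1 = wt w := by
  rw [wt_eq_card, wt_eq_card]
  have h : (univ.filter fun j => dropAt w i j = true) =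
      (univ.filter fun j => w j = true).erase i := by
    ext j
    by_cases hj : j = i <;> simp [dropAt, Function.update_apply, hj]
  rw [h, Finset.card_erase_add_one (by simpa using hi)]

theorem eq_of_wt_le {m : ℕ} {v w : Fin m → Bool} (h : ∀ i, v i = true → w i = true)
    (hwt : wt w ≤ wt v) : v = w := by
  rw [wt_eq_card, wt_eq_card] at hwt
  have := Finset.eq_of_subset_of_card_le (s := {i | v i = true}) (t := {i | w i = true})
    (fun i hi => by simpa using h i (by simpa using hi)) hwt
  funext i
  have hi := Finset.ext_iff.1 this i
  simp only [Finset.mem_filter, Finset.mem_univ, true_and] at hi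
  exact Bool.eq_iff_iff.2 hi

theorem exists_of_wt_lt {m : ℕ} {v w : Fin m → Bool} (hwt : wt v < wt w) :
    ∃ i, w i = true ∧ v i = false := by
  by_contra! h
  have hle : wt w ≤ wt v := by
    rw [wt_eq_card, wt_eq_card]
    refine Finset.card_le_card fun i hi => ?_
    simpa using h i (by simpa using hi)
  omega

theorem isWtChain_snoc_iff {m n : ℕ} {w x : Fin m → Bool} (hw : wt w = n + 1)
    (ch : Fin n → Fin m → Bool) :
    IsWtChain (n + 1) w (Fin.snoc ch x) ↔
      x = w ∧ ∃ i, w i = true ∧ IsWtChain n (dropAt w i) ch := by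
  constructor
  · rintro ⟨h1, h2, h3⟩
    have hx : x = w := by simpa using h2 (Fin.last n) (by simp)
    subst hx
    refine ⟨rfl, ?_⟩
    have h1' : ∀ j : Fin n, wt (ch j) = j.val + 1 := fun j => by
      simpa using h1 j.castSucc
    have h3' : ∀ j j' : Fin n, j'.val = j.val + 1 → ∀ i, ch j i = true → ch j' i = true :=
      fun j j' hj i hi => by
        simpa using h3 j.castSucc j'.castSucc (by simpa using hj) i (by simpa using hi)
    rcases n with _ | n
    · obtain ⟨i, hi, -⟩ := exists_of_wt_lt (v := fun _ => false) (w := x)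
        (by simp [wt_eq_card x] at hw ⊢; simp [wt, hw])
      exact ⟨i, hi, h1', fun j => j.elim0, h3'⟩
    · have hl : ∀ i, ch (Fin.last n) i = true → x i = true := fun i hi => by
        simpa using h3 (Fin.last n).castSucc (Fin.last (n + 1)) (by simp) i
          (by rwa [Fin.snoc_castSucc])
      have hlw : wt (ch (Fin.last n)) = n + 1 := by simpa using h1' (Fin.last n)
      obtain ⟨i, hi, hi'⟩ := exists_of_wt_lt (v := ch (Fin.last n)) (w := x) (by omega)
      refine ⟨i, hi, h1', fun j hj => ?_, h3'⟩
      obtain rfl : j = Fin.last n := Fin.ext (by simpa using hj)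
      have := wt_dropAt hi
      refine eq_of_wt_le (fun k hk => ?_) (by omega)
      by_cases hki : k = i
      · subst hki; simp [hi'] at hk
      · simpa [dropAt, hki] using hl k hk
  · rintro ⟨rfl, i, hi, h1, h2, h3⟩
    refine ⟨fun j => ?_, fun j hj => ?_, fun j j' hj k hk => ?_⟩
    · induction j using Fin.lastCases with
      | last => simpa using hw
      | cast j => simpa using h1 j
    · obtain rfl : j = Fin.last n := Fin.ext (by simpa using hj)
      simp
    · induction j using Fin.lastCases with
      | last => have := j'.isLt; simp at hj; omega
      | cast j =>
        rw [Fin.snoc_castSucc] at hk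
        induction j' using Fin.lastCases with
        | last =>
          rw [h2 j (by simp at hj; omega)] at hk
          by_cases hki : k = i
          · subst hki; simpa using hi
          · simpa [dropAt, hki] using hk
        | cast j' => simpa using h3 j j' (by simpa using hj) k hk

theorem isWtChain_dropAt_unique {m n : ℕ} {w : Fin m → Bool} (hw : wt w = n + 1)
    {ch : Fin n → Fin m → Bool} {i j : Fin m} (hi : w i = true) (hj : w j = true)
    (hci : IsWtChain n (dropAt w i) ch) (hcj : IsWtChain n (dropAt w j) ch) : i = j := by
  rcases n with _ | n
  · rw [wt_eq_card] at hw
    exact Finset.card_le_one.1 hw.le i (by simpa using hi) j (by simpa using hj)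
  · by_contra hij
    have h := (hci.2.1 (Fin.last n) (by simp)).symm.trans (hcj.2.1 (Fin.last n) (by simp))
    have := congrFun h i
    simp [dropAt, hij, hi] at this

theorem chainSum_succ {m : ℕ} (γ : (Fin m → Bool) → ℂ) {n : ℕ} {w : Fin m → Bool}
    (hw : wt w = n + 1) :
    chainSum γ (n + 1) w =
      1 / γ w * ∑ i, if w i = true then chainSum γ n (dropAt w i) else 0 := by
  have hsplit : ∀ ch : Fin n → Fin m → Bool,
      (if ∃ i, w i = true ∧ IsWtChain n (dropAt w i) ch then ∏ j, 1 / γ (ch j) else 0) =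
        ∑ i, if w i = true then
          (if IsWtChain n (dropAt w i) ch then ∏ j, 1 / γ (ch j) else 0) else 0 := by
    intro ch
    split_ifs with h
    · obtain ⟨i, hi, hc⟩ := h
      rw [Finset.sum_eq_single i]
      · simp [hi, hc]
      · intro j _ hji
        by_cases hj : w j = true
        · rw [if_pos hj, if_neg]
          exact fun hcj => hji (isWtChain_dropAt_unique hw hj hi hcj hc)
        · rw [if_neg hj]
      · simp
    · push Not at h
      refine (Finset.sum_eq_zero fun i _ => ?_).symm
      by_cases hi : w i = true
      · rw [if_pos hi, if_neg (h i hi)]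
      · rw [if_neg hi]
  have hsum : chainSum γ (n + 1) w =
      ∑ x : Fin m → Bool, ∑ ch : Fin n → Fin m → Bool,
        if IsWtChain (n + 1) w (Fin.snoc ch x) then
          ∏ j, 1 / γ ((Fin.snoc ch x : Fin (n + 1) → Fin m → Bool) j) else 0 := by
    rw [chainSum, ← Fintype.sum_prod_type']
    exact ((Fin.snocEquiv fun _ : Fin (n + 1) => Fin m → Bool).sum_comp _).symm
  rw [hsum, Finset.sum_eq_single w]
  · have h : ∀ ch : Fin n → Fin m → Bool,
        (if IsWtChain (n + 1) w (Fin.snoc ch w) then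
          ∏ j, 1 / γ ((Fin.snoc ch w : Fin (n + 1) → Fin m → Bool) j) else 0) =
        1 / γ w * ∑ i, if w i = true then
          (if IsWtChain n (dropAt w i) ch then ∏ j, 1 / γ (ch j) else 0) else 0 := by
      intro ch
      rw [← hsplit ch, Fin.prod_univ_castSucc]
      simp only [isWtChain_snoc_iff hw, true_and, Fin.snoc_castSucc, Fin.snoc_last]
      split_ifs <;> ring
    rw [Finset.sum_congr rfl fun ch _ => h ch, ← Finset.mul_sum, Finset.sum_comm]
    congr 1
    refine Finset.sum_congr rfl fun i _ => ?_
    split_ifs <;> simp [chainSum]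
  · intro x _ hx
    refine Finset.sum_eq_zero fun ch _ => if_neg ?_
    rw [isWtChain_snoc_iff hw]
    exact fun h => hx h.1
  · simp

theorem Aw_zero {m : ℕ} (γ : (Fin m → Bool) → ℂ) : Aw γ (fun _ => false) = 1 := by
  have h : wt (fun _ : Fin m => false) = 0 := by simp [wt]
  rw [Aw_eq_chainSum, h, chainSum]
  simp [IsWtChain]

theorem gamma_mul_Aw {m : ℕ} {γ : (Fin m → Bool) → ℂ} (hγ : ∀ w, γ w ≠ 0)
    (w : Fin m → Bool) :
    γ w * Aw γ w = (if w = fun _ => false then γ (fun _ => false) else 0) +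
      ∑ i, if w i = true then Aw γ (dropAt w i) else 0 := by
  by_cases hw : w = fun _ => false
  · subst hw
    simp [Aw_zero]
  · obtain ⟨i, hi⟩ : ∃ i, w i = true := by
      by_contra! h
      exact hw (funext fun i => by simpa using h i)
    obtain ⟨n, hn⟩ : ∃ n, wt w = n + 1 := ⟨_, (wt_dropAt hi).symm⟩
    rw [if_neg hw, zero_add, Aw_eq_chainSum, hn, chainSum_succ γ hn, ← mul_assoc,
      mul_one_div_cancel (hγ w), one_mul]
    refine Finset.sum_congr rfl fun j _ => ?_
    split_ifs with hj
    · have := wt_dropAt hj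
      rw [Aw_eq_chainSum, show wt (dropAt w j) = n by omega]
    · rfl

theorem flipv_involutive {m : ℕ} (k : Fin m) : Function.Involutive (flipv k) := by
  intro v
  simp [flipv]

theorem prod_flipv {m : ℕ} (x : Fin m → ℂ) (i : Fin m) {w : Fin m → Bool}
    (hi : w i = false) :
    (∏ j, if flipv i w j = true then x j else 1) =
      x i * ∏ j, if w j = true then x j else 1 := by
  rw [← Finset.mul_prod_erase _ _ (mem_univ i),
    ← Finset.mul_prod_erase _ (fun j => if w j = true then x j else 1) (mem_univ i)]
  have h : ∀ j ∈ univ.erase i, (if flipv i w j = true then x j else 1) =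
      if w j = true then x j else 1 := fun j hj => by
    simp [flipv, Finset.ne_of_mem_erase hj]
  rw [Finset.prod_congr rfl h]
  simp [flipv, hi]

theorem sum_dropAt_mul {m : ℕ} (A : (Fin m → Bool) → ℂ) (x : Fin m → ℂ) (i : Fin m) :
    (∑ w, (if w i = true then A (dropAt w i) else 0) * ∏ j, if w j = true then x j else 1) =
      ∑ w, A w * (∏ j, if w j = true then x j else 1) * if w i = true then 0 else x i := by
  refine (Fintype.sum_equiv (flipv_involutive i).toPerm _ _ fun w => ?_).symm
  change _ = (if flipv i w i = true then A (dropAt (flipv i w) i) else 0) *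
    ∏ j, if flipv i w j = true then x j else 1
  by_cases hi : w i = true
  · simp [flipv, hi]
  · have hi : w i = false := by simpa using hi
    have hd : dropAt (flipv i w) i = w := by
      rw [dropAt, flipv, Function.update_idem, ← hi, Function.update_eq_self]
    have hf : flipv i w i = true := by simp [flipv, hi]
    rw [if_pos hf, hd, prod_flipv x i hi, hi]
    simp only [Bool.false_eq_true, if_false]
    ring

theorem gammaP_eq {m : ℕ} (a : ℂ) (c : Fin m → ℂ) (w : Fin m → Bool) :
    gammaP a c w = a - ∑ i, if w i = true then c i - 1 else 0 := by
  have h : (wt w : ℂ) = ∑ i, if w i = true then 1 else 0 := by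
    simp [wt]
  rw [gammaP, h, sub_add, ← Finset.sum_sub_distrib]
  congr 1
  refine Finset.sum_congr rfl fun i _ => ?_
  split_ifs <;> simp

/-- The eigenvalue identity `∑_{w ⪯ u} A_w ∏_{i ∈ w} (c_i - 1) = a / γ_u`. -/
theorem sum_Aw_mul_prod {m : ℕ} (a : ℂ) (c : Fin m → ℂ)
    (hγ : ∀ w : Fin m → Bool, gammaP a c w ≠ 0) (u : Fin m → Bool) :
    (∑ w, Aw (gammaP a c) w *
      ∏ i, if w i = true then (if u i = true then c i - 1 else 0) else 1) =
      a / gammaP a c u := by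
  set A := Aw (gammaP a c)
  set x : Fin m → ℂ := fun i => if u i = true then c i - 1 else 0 with hx
  have hkey : ∀ w : Fin m → Bool,
      gammaP a c u * (∏ i, if w i = true then x i else 1) =
        gammaP a c w * (∏ i, if w i = true then x i else 1) -
          (∏ i, if w i = true then x i else 1) * ∑ i, if w i = true then 0 else x i := by
    intro w
    by_cases hle : ∀ i, w i = true → u i = true
    · have : gammaP a c u = gammaP a c w - ∑ i, if w i = true then 0 else x i := by
        rw [gammaP_eq, gammaP_eq, sub_sub, ← Finset.sum_add_distrib]
        congr 1
        refine Finset.sum_congr rfl fun i _ => ?_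
        by_cases hi : w i = true
        · simp [hi, hle i hi]
        · simp [hi, hx]
      rw [this]
      ring
    · push Not at hle
      obtain ⟨i, hi, hui⟩ := hle
      have : (∏ i, if w i = true then x i else 1) = 0 :=
        Finset.prod_eq_zero (mem_univ i) (by simp [hi, hx, hui])
      rw [this]
      ring
  have h0 : gammaP a c (fun _ => false) = a := by simp [gammaP_eq]
  rw [eq_div_iff (hγ u), mul_comm, Finset.mul_sum]
  have hterm : ∀ w : Fin m → Bool,
      gammaP a c u * (A w * ∏ i, if w i = true then x i else 1) =
        (if w = fun _ => false then a else 0) +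
        ((∑ i, (if w i = true then A (dropAt w i) else 0) *
            ∏ i, if w i = true then x i else 1) -
          ∑ i, A w * (∏ i, if w i = true then x i else 1) * if w i = true then 0 else x i) := by
    intro w
    rw [mul_left_comm, hkey w, mul_sub, ← mul_assoc, mul_comm (A w), gamma_mul_Aw hγ w, h0,
      add_mul, Finset.sum_mul, ← mul_assoc, Finset.mul_sum, add_sub_assoc]
    congr 1
    split_ifs with hw
    · simp [hw]
    · simp
  rw [Finset.sum_congr rfl fun w _ => hterm w, Finset.sum_add_distrib, Finset.sum_sub_distrib,
    Finset.sum_comm, Finset.sum_congr rfl fun i _ => sum_dropAt_mul A x i, Finset.sum_comm]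
  simp

/-- The Kronecker product of a family of `2 × 2` matrices. -/
def kron {m : ℕ} (M : Fin m → Matrix Bool Bool ℂ) :
    Matrix (Fin m → Bool) (Fin m → Bool) ℂ :=
  fun v v' => ∏ i, M i (v i) (v' i)

theorem kron_mul {m : ℕ} (M N : Fin m → Matrix Bool Bool ℂ) :
    kron M * kron N = kron fun i => M i * N i := by
  ext v v'
  simp only [kron, Matrix.mul_apply, ← Finset.prod_mul_distrib]
  rw [Finset.prod_univ_sum, Fintype.piFinset_univ]

theorem det_of_le_triangular {α : Type*} [Fintype α] [DecidableEq α] [PartialOrder α]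
    (M : Matrix α α ℂ) (h : ∀ i j, ¬ i ≤ j → M i j = 0) : M.det = ∏ i, M i i := by
  let : Fintype (LinearExtension α) := inferInstanceAs (Fintype α)
  let e : α ≃ LinearExtension α := Equiv.refl α
  rw [← Matrix.det_reindex_self e M, Matrix.det_of_isUpperTriangular]
  · exact e.symm.prod_comp fun i => M i i
  · exact fun i j hij => h (e.symm i) (e.symm j) fun hle =>
      not_lt_of_ge (toLinearExtension.monotone hle) hij

theorem kron_apply_eq_zero {m : ℕ} {M : Fin m → Matrix Bool Bool ℂ}
    (hM : ∀ i, M i true false = 0) (v v' : Fin m → Bool) (h : ¬ v ≤ v') :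
    kron M v v' = 0 := by
  rw [Pi.le_def] at h
  push Not at h
  obtain ⟨i, hi⟩ := h
  refine Finset.prod_eq_zero (mem_univ i) ?_
  obtain ⟨h1, h2⟩ := Bool.lt_iff.1 hi
  rw [h1, h2, hM]

theorem prod_prod_apply {m : ℕ} (hm : 1 ≤ m) (g : Bool → Fin m → ℂ) :
    (∏ v : Fin m → Bool, ∏ i, g (v i) i) =
      ∏ i, (g false i * g true i) ^ (2 ^ (m - 1)) := by
  obtain ⟨n, rfl⟩ : ∃ n, m = n + 1 := ⟨m - 1, by omega⟩
  rw [Finset.prod_comm]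
  refine Finset.prod_congr rfl fun i _ => ?_
  rw [← (Fin.insertNthEquiv (fun _ => Bool) i).prod_comp, Fintype.prod_prod_type]
  simp [mul_pow, mul_comm]

/-- **Proposition 3.5 (determinant formula).** If `β_{0,i} ≠ 0`, `β_{1,i} ≠ 0` and
`γ_w ≠ 0` for all `i`, `w` (note `γ_{(0,…,0)} = a`), then
`det C = a^{2^m} / ((∏_w γ_w)·(∏_i (β_{0,i} β_{1,i})^{2^{m−1}}))`;
in particular `C` is invertible. -/
theorem stmt_3 (m : ℕ) (hm : 1 ≤ m) (a : ℂ) (b c : Fin m → ℂ)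
    (hb0 : ∀ i, betaP b c false i ≠ 0) (hb1 : ∀ i, betaP b c true i ≠ 0)
    (hγ : ∀ w : Fin m → Bool, gammaP a c w ≠ 0) :
    (Cmat a b c).det =
        a ^ (2 ^ m) /
          ((∏ w : Fin m → Bool, gammaP a c w) *
            ∏ i, (betaP b c false i * betaP b c true i) ^ (2 ^ (m - 1))) ∧
      IsUnit (Cmat a b c).det := by
  set Q : Fin m → Matrix Bool Bool ℂ := fun _ s t =>
    if s = t then 1 else if t then -1 else 0 with hQ
  set R : Fin m → Matrix Bool Bool ℂ := fun i s t =>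
    if s = t then betaP b c s i else if t then betaP b c s i else 0 with hR
  set E : (Fin m → Bool) → Fin m → Matrix Bool Bool ℂ := fun w i s t =>
    if w i = true then 1 else (if s = t then 1 else 0) / betaP b c s i with hE
  set T : (Fin m → Bool) → Fin m → Matrix Bool Bool ℂ := fun w i s t =>
    if w i = true then (if s then (if t then c i - 1 else betaP b c false i) else 0)
      else if s = t then 1 else 0 with hT
  have hC : Cmat a b c = ∑ w, Aw (gammaP a c) w • kron (E w) := by
    ext v v'
    simp only [Cmat, Matrix.sum_apply, Matrix.smul_apply, smul_eq_mul, kron]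
    refine Finset.sum_congr rfl fun w _ => ?_
    rw [Finset.prod_filter]
    congr 1
    refine Finset.prod_congr rfl fun i _ => ?_
    cases hw : w i <;> simp [hE, hw]
  have hfactor : ∀ w i, Q i * E w i * R i = T w i := by
    intro w i
    have h0 := hb0 i
    have h1 := hb1 i
    ext s t
    simp only [Matrix.mul_apply, Fintype.sum_bool]
    simp only [hQ, hE, hR, hT]
    cases hw : w i <;> cases s <;> cases t <;> (simp [h0, h1]; try simp [betaP])
  have hQCR : kron Q * Cmat a b c * kron R = ∑ w, Aw (gammaP a c) w • kron (T w) := by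
    rw [hC, Finset.mul_sum, Finset.sum_mul]
    refine Finset.sum_congr rfl fun w _ => ?_
    rw [Matrix.mul_smul, Matrix.smul_mul, kron_mul, kron_mul]
    simp only [hfactor]
  have hdQ : (kron Q).det = 1 := by
    rw [det_of_le_triangular _ (kron_apply_eq_zero fun i => by simp [hQ])]
    simp [kron, hQ]
  have hdR : (kron R).det =
      ∏ i, (betaP b c false i * betaP b c true i) ^ (2 ^ (m - 1)) := by
    rw [det_of_le_triangular _ (kron_apply_eq_zero fun i => by simp [hR])]
    simp only [kron, hR, if_true]
    exact prod_prod_apply hm (betaP b c)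
  have hdT : (∑ w, Aw (gammaP a c) w • kron (T w)).det =
      a ^ (2 ^ m) / ∏ w : Fin m → Bool, gammaP a c w := by
    rw [← Matrix.det_transpose, det_of_le_triangular]
    · have h : ∀ u : Fin m → Bool,
          (∑ w, Aw (gammaP a c) w • kron (T w)).transpose u u = a / gammaP a c u := by
        intro u
        rw [← sum_Aw_mul_prod a c hγ u, Matrix.transpose_apply, Matrix.sum_apply]
        refine Finset.sum_congr rfl fun w _ => ?_
        rw [Matrix.smul_apply, smul_eq_mul, kron]
        congr 1
        refine Finset.prod_congr rfl fun i _ => ?_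
        cases hu : u i <;> simp [hT]
      rw [Finset.prod_congr rfl fun u _ => h u, Finset.prod_div_distrib]
      simp
    · intro v v' h
      rw [Matrix.transpose_apply, Matrix.sum_apply]
      refine Finset.sum_eq_zero fun w _ => ?_
      have := kron_apply_eq_zero (M := fun i => (T w i).transpose)
        (fun i => by rw [Matrix.transpose_apply]; simp [hT]) v v' h
      simp only [kron, Matrix.transpose_apply] at this
      rw [Matrix.smul_apply, kron, this, smul_zero]
  have hβ : (∏ i, (betaP b c false i * betaP b c true i) ^ (2 ^ (m - 1))) ≠ 0 :=
    Finset.prod_ne_zero_iff.2 fun i _ => pow_ne_zero _ (mul_ne_zero (hb0 i) (hb1 i))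
  have hγ' : (∏ w : Fin m → Bool, gammaP a c w) ≠ 0 :=
    Finset.prod_ne_zero_iff.2 fun w _ => hγ w
  have ha : a ≠ 0 := by
    have := hγ fun _ => false
    rwa [gammaP_eq, show (∑ i : Fin m, if false = true then c i - 1 else 0) = 0 by simp,
      sub_zero] at this
  have hdet : (Cmat a b c).det =
      a ^ (2 ^ m) / ((∏ w : Fin m → Bool, gammaP a c w) *
        ∏ i, (betaP b c false i * betaP b c true i) ^ (2 ^ (m - 1))) := by
    rw [← div_div, eq_div_iff hβ, ← hdT, ← hQCR, Matrix.det_mul, Matrix.det_mul, hdQ, hdR,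
      one_mul]
  refine ⟨hdet, ?_⟩
  rw [hdet, isUnit_iff_ne_zero]
  exact div_ne_zero (pow_ne_zero _ ha) (mul_ne_zero hγ' hβ)
end

section
/- Let m ≥ 1 and b_1,…,b_m, c_1,…,c_m ∈ ℂ with β_{0,i} = b_i and β_{1,i} = c_i − 1 − b_i ≠ 0 for all i. Define two 2^m × 2^m matrices P and Q indexed by {0,1}^m, where v ⪰ w means (w_i = 1 ⟹ v_i = 1): P_{v,w} = ∏_{i: v_i = 1} (−β_{w_i,i}) if v ⪰ w and P_{v,w} = 0 otherwise; Q_{v,w} = (∏_{i: v_i = 1, w_i = 0} β_{0,i}) / (∏_{i: v_i = 1} (−β_{1,i})) if v ⪰ w and Q_{v,w} = 0 otherwise. Then P·Q = Q·P = I_{2^m}; in particular P is invertible with inverse Q. -/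
open Finset
open scoped Classical

/-- The matrix `P` of Corollary 4.12:
`P_{v,w} = ∏_{i: v_i = 1} (−β_{w_i,i})` if `v ⪰ w`, and `0` otherwise. -/
noncomputable def Pmat {m : ℕ} (b c : Fin m → ℂ) :
    Matrix (Fin m → Bool) (Fin m → Bool) ℂ :=
  fun v w =>
    if ∀ i, w i = true → v i = true then
      ∏ i ∈ univ.filter (fun i => v i = true), (-betaP b c (w i) i)
    else 0

/-- The matrix `Q` (the claimed inverse of `P`):
`Q_{v,w} = (∏_{i: v_i = 1, w_i = 0} β_{0,i}) / (∏_{i: v_i = 1} (−β_{1,i}))` if `v ⪰ w`,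
and `0` otherwise. -/
noncomputable def Qmat {m : ℕ} (b c : Fin m → ℂ) :
    Matrix (Fin m → Bool) (Fin m → Bool) ℂ :=
  fun v w =>
    if ∀ i, w i = true → v i = true then
      (∏ i ∈ univ.filter (fun i => v i = true ∧ w i = false), betaP b c false i) /
        ∏ i ∈ univ.filter (fun i => v i = true), (-betaP b c true i)
    else 0

/-- The Kronecker product of a family of square matrices, indexed by functions. -/
def piKronecker {ι κ R : Type*} [Fintype ι] [CommSemiring R] (A : ι → Matrix κ κ R) :
    Matrix (ι → κ) (ι → κ) R :=
  fun v w => ∏ i, A i (v i) (w i)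

theorem piKronecker_mul {ι κ R : Type*} [Fintype ι] [DecidableEq ι] [Fintype κ]
    [CommSemiring R]
    (A B : ι → Matrix κ κ R) :
    piKronecker A * piKronecker B = piKronecker fun i => A i * B i := by
  ext v w
  simp only [piKronecker, Matrix.mul_apply, prod_univ_sum, Fintype.piFinset_univ,
    prod_mul_distrib]

theorem piKronecker_one {ι κ R : Type*} [Fintype ι] [DecidableEq κ] [DecidableEq (ι → κ)]
    [CommSemiring R] :
    piKronecker (fun _ : ι => (1 : Matrix κ κ R)) = 1 := by
  ext v w
  simp only [piKronecker, Matrix.one_apply, Fintype.prod_boole, funext_iff]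

/-- The Kronecker factor of `Pmat` at a single index. -/
noncomputable def Pfactor {m : ℕ} (b c : Fin m → ℂ) (i : Fin m) : Matrix Bool Bool ℂ :=
  fun s t => if t = true → s = true then (if s = true then -betaP b c t i else 1) else 0

/-- The Kronecker factor of `Qmat` at a single index. -/
noncomputable def Qfactor {m : ℕ} (b c : Fin m → ℂ) (i : Fin m) : Matrix Bool Bool ℂ :=
  fun s t =>
    if t = true → s = true then
      (if s = true ∧ t = false then betaP b c false i else 1) /
        (if s = true then -betaP b c true i else 1)
    else 0

theorem Pmat_eq_piKronecker {m : ℕ} (b c : Fin m → ℂ) :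
    Pmat b c = piKronecker (Pfactor b c) := by
  ext v w
  simp only [Pmat, piKronecker, Pfactor, Fintype.prod_ite_zero, prod_filter]
  congr

theorem Qmat_eq_piKronecker {m : ℕ} (b c : Fin m → ℂ) :
    Qmat b c = piKronecker (Qfactor b c) := by
  ext v w
  simp only [Qmat, piKronecker, Qfactor, Fintype.prod_ite_zero, prod_filter, prod_div_distrib]

theorem Pfactor_mul_Qfactor {m : ℕ} (b c : Fin m → ℂ) (i : Fin m)
    (h : betaP b c true i ≠ 0) : Pfactor b c i * Qfactor b c i = 1 := by
  ext s t
  cases s <;> cases t <;> simp [Matrix.mul_apply, Pfactor, Qfactor] <;> field_simp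
  ring

/-- **Corollary 4.12 and final Remark.** If `β_{1,i} ≠ 0` for all `i`, then
`P·Q = Q·P = I`; in particular `P` is invertible with inverse `Q`. -/
theorem stmt_8 (m : ℕ) (hm : 1 ≤ m) (b c : Fin m → ℂ)
    (hb1 : ∀ i, betaP b c true i ≠ 0) :
    Pmat b c * Qmat b c = 1 ∧ Qmat b c * Pmat b c = 1 := by
  have hPQ : Pmat b c * Qmat b c = 1 := by
    rw [Pmat_eq_piKronecker, Qmat_eq_piKronecker, piKronecker_mul,
      funext fun i => Pfactor_mul_Qfactor b c i (hb1 i), piKronecker_one]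
  exact ⟨hPQ, mul_eq_one_comm.mp hPQ⟩
end

section
/- Let m ≥ 1 and a, b_1,…,b_m, c_1,…,c_m ∈ ℂ with a ≠ 0, β_{0,i} = b_i ≠ 0, β_{1,i} = c_i − 1 − b_i ≠ 0 for all i, and γ_w = a − Σ_i w_i c_i + |w| ≠ 0 for all w ∈ {0,1}^m. Let C be the {0,1}^m-indexed matrix with C_{v,v'} = Σ_{w∈{0,1}^m} A_w ∏_{i: w_i=0} δ(v_i,v'_i)/β_{v_i,i} (A_w the sum over maximal chains below w of ∏ 1/γ_{w^{(j)}}, A_{(0,…,0)} = 1), and for k ∈ {1,…,m} let R_k be the {0,1}^m-indexed matrix with (R_k)_{v,v} = −β_{v_k,k}, (R_k)_{v,σ_k·v} = −β_{1−v_k,k} (σ_k·v being v with the k-th coordinate flipped), and all other entries 0. Then R_k·C = C·R_kᵀ; i.e. the matrix R_k·C is symmetric. -/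
open Finset
open scoped Classical

/-- `Σβ_v = Σ_i β_{v_i,i}`. -/
noncomputable def Sbeta {m : ℕ} (b c : Fin m → ℂ) (v : Fin m → Bool) : ℂ :=
  ∑ i, betaP b c (v i) i

/-- `Πβ_v = ∏_i β_{v_i,i}`. -/
noncomputable def Pbeta {m : ℕ} (b c : Fin m → ℂ) (v : Fin m → Bool) : ℂ :=
  ∏ i, betaP b c (v i) i

/-- The standard basis row vector `e_v` of `ℂ^{2^m}`, `(e_v)_w = δ_{v,w}`. -/
noncomputable def evec {m : ℕ} (v : Fin m → Bool) : (Fin m → Bool) → ℂ :=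
  fun w => if w = v then 1 else 0

/-- The coordinate row vector `f_v = ((a − Σβ_v)/a) e_v − Σ_j (β_{1−v_j,j}/a) e_{σ_j·v}`
of the class `ψ_v` in the frame `(φ_v)`. -/
noncomputable def fvec {m : ℕ} (a : ℂ) (b c : Fin m → ℂ) (v : Fin m → Bool) :
    (Fin m → Bool) → ℂ :=
  ((a - Sbeta b c v) / a) • evec v - ∑ j, (betaP b c (!(v j)) j / a) • evec (flipv j v)

/-- The residue matrix `R_k`: `(R_k)_{v,v} = −β_{v_k,k}`, `(R_k)_{v,σ_k·v} = −β_{1−v_k,k}`,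
all other entries `0`. -/
noncomputable def Rmat {m : ℕ} (b c : Fin m → ℂ) (k : Fin m) :
    Matrix (Fin m → Bool) (Fin m → Bool) ℂ :=
  fun v w =>
    if w = v then -betaP b c (v k) k
    else if w = flipv k v then -betaP b c (!(v k)) k
    else 0

lemma flipv_ne {m : ℕ} (k : Fin m) (v : Fin m → Bool) : flipv k v ≠ v := by
  intro h
  have := congrFun h k
  simp [flipv] at this

lemma delta_div_betaP_symm {m : ℕ} (b c : Fin m → ℂ) (v v' : Fin m → Bool) (i : Fin m) :
    (if v i = v' i then (1 : ℂ) else 0) / betaP b c (v i) i =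
      (if v' i = v i then 1 else 0) / betaP b c (v' i) i := by
  by_cases h : v i = v' i
  · rw [h]
  · rw [if_neg h, if_neg (Ne.symm h)]; simp

lemma Cmat_transpose {m : ℕ} (a : ℂ) (b c : Fin m → ℂ) :
    (Cmat a b c).transpose = Cmat a b c := by
  ext v v'
  simp only [Matrix.transpose_apply, Cmat]
  exact sum_congr rfl fun w _ => by
    rw [prod_congr rfl fun i _ => delta_div_betaP_symm b c v' v i]

lemma Rmat_mul_apply {m : ℕ} (b c : Fin m → ℂ) (k : Fin m)
    (M : Matrix (Fin m → Bool) (Fin m → Bool) ℂ) (v v' : Fin m → Bool) :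
    (Rmat b c k * M) v v' =
      -(betaP b c (v k) k * M v v' + betaP b c (!(v k)) k * M (flipv k v) v') := by
  have hR : ∀ u, Rmat b c k v u * M u v' =
      (if u = v then -(betaP b c (v k) k * M v v') else 0) +
        (if u = flipv k v then -(betaP b c (!(v k)) k * M (flipv k v) v') else 0) := by
    intro u
    by_cases h : u = v
    · subst h
      simp [Rmat, (flipv_ne k u).symm]
    · by_cases h' : u = flipv k v
      · subst h'
        simp [Rmat, flipv_ne]
      · simp [Rmat, h, h']
  rw [Matrix.mul_apply, sum_congr rfl fun u _ => hR u, sum_add_distrib]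
  simp only [sum_ite_eq', mem_univ, if_true]
  ring

/-- Applying the residue at `x_k = 0` to one summand of the intersection matrix removes the
dependence on the `k`-th coordinate. -/
lemma betaP_mul_prod_add_flipv {m : ℕ} (b c : Fin m → ℂ)
    (hβ : ∀ s i, betaP b c s i ≠ 0) (k : Fin m) (w v v' : Fin m → Bool) :
    betaP b c (v k) k * ∏ i ∈ univ.filter (fun i => w i = false),
        (if v i = v' i then (1 : ℂ) else 0) / betaP b c (v i) i +
      betaP b c (!(v k)) k * ∏ i ∈ univ.filter (fun i => w i = false),
        (if flipv k v i = v' i then (1 : ℂ) else 0) / betaP b c (flipv k v i) i =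
    (if w k = false then 1 else betaP b c false k + betaP b c true k) *
      ∏ i ∈ (univ.filter (fun i => w i = false)).erase k,
        (if v i = v' i then (1 : ℂ) else 0) / betaP b c (v i) i := by
  have hflip : ∏ i ∈ (univ.filter (fun i => w i = false)).erase k,
        (if flipv k v i = v' i then (1 : ℂ) else 0) / betaP b c (flipv k v i) i =
      ∏ i ∈ (univ.filter (fun i => w i = false)).erase k,
        (if v i = v' i then (1 : ℂ) else 0) / betaP b c (v i) i :=
    prod_congr rfl fun i hi => by
      simp only [flipv, Function.update_of_ne (ne_of_mem_erase hi)]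
  by_cases hk : w k = false
  · have hmem : k ∈ univ.filter (fun i => w i = false) := by simp [hk]
    rw [← mul_prod_erase _ _ hmem, ← mul_prod_erase _ _ hmem, hflip, if_pos hk]
    have hkflip : flipv k v k = !(v k) := by simp [flipv]
    rw [hkflip, ← mul_assoc, ← mul_assoc, ← add_mul, mul_div_cancel₀ _ (hβ _ _),
      mul_div_cancel₀ _ (hβ _ _)]
    congr 1
    cases v k <;> cases v' k <;> simp
  · have hmem : k ∉ univ.filter (fun i => w i = false) := by simp [hk]
    rw [erase_eq_of_notMem hmem] at hflip ⊢
    rw [hflip, if_neg hk, ← add_mul]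
    congr 1
    cases v k <;> simp [add_comm]

lemma Rmat_mul_Cmat_transpose {m : ℕ} (a : ℂ) (b c : Fin m → ℂ)
    (hβ : ∀ s i, betaP b c s i ≠ 0) (k : Fin m) :
    (Rmat b c k * Cmat a b c).transpose = Rmat b c k * Cmat a b c := by
  have key : ∀ v v', (Rmat b c k * Cmat a b c) v v' =
      -∑ w, Aw (gammaP a c) w *
        ((if w k = false then 1 else betaP b c false k + betaP b c true k) *
          ∏ i ∈ (univ.filter (fun i => w i = false)).erase k,
            (if v i = v' i then (1 : ℂ) else 0) / betaP b c (v i) i) := by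
    intro v v'
    rw [Rmat_mul_apply]
    simp only [Cmat]
    rw [mul_sum, mul_sum, ← sum_add_distrib]
    congr 1
    refine sum_congr rfl fun w _ => ?_
    rw [← betaP_mul_prod_add_flipv b c hβ k w v v']
    ring
  ext v v'
  rw [Matrix.transpose_apply, key, key]
  congr 1
  exact sum_congr rfl fun w _ => by
    rw [prod_congr rfl fun i _ => delta_div_betaP_symm b c v' v i]

open Matrix in
/-- **Lemma 4.4 / Proposition 4.5(i), matrix form for the residue at `x_k = 0`:**
`R_k·C = C·R_kᵀ`; i.e. the matrix `R_k·C` is symmetric. -/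
theorem stmt_10 (m : ℕ) (hm : 1 ≤ m) (a : ℂ) (b c : Fin m → ℂ) (ha : a ≠ 0)
    (hb0 : ∀ i, betaP b c false i ≠ 0) (hb1 : ∀ i, betaP b c true i ≠ 0)
    (hγ : ∀ w : Fin m → Bool, gammaP a c w ≠ 0) (k : Fin m) :
    Rmat b c k * Cmat a b c = Cmat a b c * (Rmat b c k)ᵀ ∧
      (Rmat b c k * Cmat a b c)ᵀ = Rmat b c k * Cmat a b c := by
  have hsymm := Rmat_mul_Cmat_transpose a b c
    (fun s i => by cases s; exacts [hb0 i, hb1 i]) k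
  refine ⟨?_, hsymm⟩
  rw [← hsymm, Matrix.transpose_mul, Cmat_transpose]
end
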